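/- Let g_θ be log-admissible with associated functions a, b, and let r_x be the unique solution of a(r) = x. Then the normalization constant of the generalized Ewens measure satisfies h_n = (2π b(r_n))^{−1/2} r_n^{−n} exp(g_θ(r_n)) (1 + o(1)) as n → ∞. -/

import Mathlib

open Filter Set Asymptotics MeasureTheory
open scoped Topology

noncomputable section

/-- `c_j(σ)`: the number of cycles of length `j` in the permutation `σ ∈ S_n`
(fixed points count as cycles of length 1). -/
def cycleCount (n j : ℕ) (σ : Equiv.Perm (Fin n)) : ℕ :=
  if j = 1 then n - σ.support.card else σ.cycleType.count j

/-- `K_{0n}(σ) = Σ_{j=1}^n c_j(σ)`: the total number of cycles of `σ`. -/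
def numCycles (n : ℕ) (σ : Equiv.Perm (Fin n)) : ℕ :=
  (n - σ.support.card) + σ.cycleType.card

/-- The unnormalized generalized Ewens weight `∏_{j=1}^n θ_j^{c_j(σ)}`. -/
def ewensWeight (θ : ℕ → ℝ) (n : ℕ) (σ : Equiv.Perm (Fin n)) : ℝ :=
  ∏ j ∈ Finset.Icc 1 n, θ j ^ cycleCount n j σ

/-- The normalization constant `h_n = (1/n!) Σ_σ ∏_j θ_j^{c_j(σ)}` of the
generalized Ewens measure (equivalently, the `n`-th coefficient of `exp g_θ`). -/
def ewensH (θ : ℕ → ℝ) (n : ℕ) : ℝ :=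
  (n.factorial : ℝ)⁻¹ * ∑ σ : Equiv.Perm (Fin n), ewensWeight θ n σ

open scoped Classical in
/-- Probability of an event under the generalized Ewens measure
`ℙ(σ) = (1/(h_n n!)) ∏_j θ_j^{c_j(σ)}`. -/
def ewensProb (θ : ℕ → ℝ) (n : ℕ) (p : Equiv.Perm (Fin n) → Prop) : ℝ :=
  (∑ σ ∈ Finset.univ.filter p, ewensWeight θ n σ) /
    ∑ σ : Equiv.Perm (Fin n), ewensWeight θ n σ

/-- Expectation under the generalized Ewens measure. -/
def ewensExpect (θ : ℕ → ℝ) (n : ℕ) (f : Equiv.Perm (Fin n) → ℝ) : ℝ :=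
  (∑ σ : Equiv.Perm (Fin n), f σ * ewensWeight θ n σ) /
    ∑ σ : Equiv.Perm (Fin n), ewensWeight θ n σ

/-- The coefficient sequence of `g_θ(t) = Σ_{k≥1} (θ_k/k) t^k`. -/
def thetaCoeff (θ : ℕ → ℝ) : ℕ → ℝ := fun k => if k = 0 then 0 else θ k / k

/-- `g_θ` as a function on the complex disc. -/
def gThetaC (θ : ℕ → ℝ) : ℂ → ℂ := fun z => ∑' k : ℕ, (thetaCoeff θ k : ℂ) * z ^ k

/-- `g_θ` as a real function. -/
def gThetaR (θ : ℕ → ℝ) : ℝ → ℝ := fun t => ∑' k : ℕ, thetaCoeff θ k * t ^ k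

/-- The standard normal cumulative distribution function. -/
def stdNormalCDF (x : ℝ) : ℝ :=
  ∫ t in Set.Iic x, Real.exp (-t ^ 2 / 2) / Real.sqrt (2 * Real.pi)

/-- `(K_{0n} - μ_n)/σ_n` converges in distribution to a standard normal random
variable, where `K_{0n}` is distributed according to the generalized Ewens
measure with weights `θ` (stated via pointwise convergence of the CDFs to the
continuous standard normal CDF). -/
def convergesToStdNormal (θ : ℕ → ℝ) (μ σ' : ℕ → ℝ) : Prop :=
  ∀ x : ℝ, Tendsto
    (fun n => ewensProb θ n fun σ => ((numCycles n σ : ℝ) - μ n) / σ' n ≤ x)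
    atTop (𝓝 (stdNormalCDF x))

/-- `log`-admissibility of a power series `g` with coefficients `gc`, radius of
convergence `ρ`, and associated functions `a`, `b`, `δ` (Definition 2.1). -/
structure IsLogAdmissible (g : ℂ → ℂ) (gc : ℕ → ℝ) (ρ : ℝ) (a b δ : ℝ → ℝ) : Prop where
  rho_pos : 0 < ρ
  coeff_nonneg : ∀ n, 0 ≤ gc n
  series : ∀ z : ℂ, ‖z‖ < ρ → HasSum (fun n => (gc n : ℂ) * z ^ n) (g z)
  radius : ∀ t : ℝ, ρ < t → ¬ Summable fun n => gc n * t ^ n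
  a_nonneg : ∀ r ∈ Set.Ico (0 : ℝ) ρ, 0 ≤ a r
  b_nonneg : ∀ r ∈ Set.Ico (0 : ℝ) ρ, 0 ≤ b r
  delta_pos : ∀ r ∈ Set.Ico (0 : ℝ) ρ, 0 < δ r
  /-- approximation: `g(re^{iφ}) = g(r) + iφa(r) - φ²b(r)/2 + R(r,φ)` with
  `R(r,φ) = o(φ³ δ(r)⁻³)` uniformly in `φ` as `r → ρ`. -/
  approx : ∃ ε : ℝ → ℝ, Tendsto ε (𝓝[<] ρ) (𝓝 0) ∧
    ∀ r ∈ Set.Ico (0 : ℝ) ρ, ∀ φ : ℝ, |φ| ≤ δ r →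
      ‖g (r * Complex.exp (φ * Complex.I)) -
          (g r + φ * Complex.I * a r - (φ : ℂ) ^ 2 / 2 * b r)‖ ≤
        ε r * |φ| ^ 3 * (δ r)⁻¹ ^ 3
  a_div : Tendsto a (𝓝[<] ρ) atTop
  b_div : Tendsto b (𝓝[<] ρ) atTop
  delta_lim : Tendsto δ (𝓝[<] ρ) (𝓝 0)
  width : ∀ ε : ℝ, 0 < ε →
    Tendsto (fun r => ε * δ r ^ 2 * b r - Real.log (b r)) (𝓝[<] ρ) atTop
  mono : ∀ r ∈ Set.Ico (0 : ℝ) ρ, ∀ φ : ℝ, δ r < |φ| → |φ| ≤ Real.pi →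
    (g (r * Complex.exp (φ * Complex.I))).re ≤
      max (g (r * Complex.exp (δ r * Complex.I))).re
        (g (r * Complex.exp (-δ r * Complex.I))).re

/-- The technical condition (*): `|r_x^{(k)}| x^k ≲ |r_x^{(k-1)}| x^{k-1}` for
all sufficiently large `x` and `2 ≤ k ≤ 4`. -/
def TechCond (r : ℝ → ℝ) : Prop :=
  ∃ C > 0, ∃ x₀ : ℝ, ∀ x ≥ x₀, ∀ k : ℕ, 2 ≤ k → k ≤ 4 →
    |iteratedDeriv k r x| * x ^ k ≤ C * |iteratedDeriv (k - 1) r x| * x ^ (k - 1)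

/-- The centralizer order `∏_{j=1}^N j^{m_j} m_j!` of a permutation with `m_j` cycles of length
`j`. -/
def zWeight (N : ℕ) (s : Multiset ℕ) : ℕ :=
  ∏ j ∈ Finset.Icc 1 N, j ^ s.count j * (s.count j).factorial

theorem zWeight_ne_zero (N : ℕ) (s : Multiset ℕ) : zWeight N s ≠ 0 := by
  refine Finset.prod_ne_zero_iff.2 fun j hj => mul_ne_zero (pow_ne_zero _ ?_)
    (Nat.factorial_ne_zero _)
  have := (Finset.mem_Icc.1 hj).1
  omega

theorem partition_eq_iff_cycleType_eq {α : Type*} [Fintype α] [DecidableEq α]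
    (σ : Equiv.Perm α) (p : (Fintype.card α).Partition) :
    σ.partition = p ↔ σ.cycleType = p.parts.filter (2 ≤ ·) := by
  constructor
  · rintro rfl
    exact Equiv.Perm.filter_parts_partition_eq_cycleType.symm
  · intro h
    have hle : (p.parts.filter (2 ≤ ·)).sum ≤ Fintype.card α ∧
        ∀ a ∈ p.parts.filter (2 ≤ ·), 2 ≤ a := by
      refine ⟨?_, fun a ha => (Multiset.mem_filter.1 ha).2⟩
      rw [← h, Equiv.Perm.sum_cycleType]
      exact σ.support.card_le_univ
    have h1 : p.parts.filter (fun n => ¬ 2 ≤ n) =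
        Multiset.replicate (Multiset.card (p.parts.filter (fun n => ¬ 2 ≤ n))) 1 := by
      refine Multiset.eq_replicate_card.2 fun b hb => ?_
      have h2 := Multiset.mem_filter.1 hb
      have := p.parts_pos h2.1
      omega
    have h3 := Multiset.filter_add_not (2 ≤ ·) p.parts
    have h4 : Multiset.card (p.parts.filter (fun n => ¬ 2 ≤ n)) =
        Fintype.card α - σ.support.card := by
      have := p.parts_sum
      rw [← h3, Multiset.sum_add, h1, ← h, Equiv.Perm.sum_cycleType] at this
      simp at this ⊢
      omega
    refine Nat.Partition.ext ?_
    rw [Equiv.Perm.parts_partition, ← h3, h1, h, h4]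

theorem card_partition_eq_mul_zWeight {α : Type*} [Fintype α] [DecidableEq α]
    (p : (Fintype.card α).Partition) :
    (Finset.univ.filter fun σ : Equiv.Perm α => σ.partition = p).card *
      zWeight (Fintype.card α) p.parts = (Fintype.card α).factorial := by
  have h := Equiv.Perm.card_of_cycleType_mul_eq α (p.parts.filter (2 ≤ ·))
  have h3 := Multiset.filter_add_not (2 ≤ ·) p.parts
  have h1 : p.parts.filter (fun n => ¬ 2 ≤ n) =
      Multiset.replicate (p.parts.count 1) 1 := by
    have : p.parts.filter (fun n => ¬ 2 ≤ n) = p.parts.filter (fun n => n = 1) := by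
      refine Multiset.filter_congr fun x hx => ?_
      have := p.parts_pos hx
      omega
    rw [this]
    exact Multiset.filter_eq' _ _
  have h4 : (p.parts.filter (2 ≤ ·)).sum + p.parts.count 1 = Fintype.card α := by
    have := p.parts_sum
    rw [← h3, Multiset.sum_add, h1] at this
    simpa using this
  rw [if_pos ⟨by omega, fun a ha => (Multiset.mem_filter.1 ha).2⟩] at h
  simp_rw [partition_eq_iff_cycleType_eq]
  rw [← h]
  congr 1
  have h5 : Fintype.card α - (p.parts.filter (2 ≤ ·)).sum = p.parts.count 1 := by omega
  have h6 : (p.parts.filter (2 ≤ ·)).prod = p.parts.prod := by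
    conv_rhs => rw [← h3, Multiset.prod_add, h1]
    simp
  have hsub : p.parts.toFinset ⊆ Finset.Icc 1 (Fintype.card α) := by
    intro x hx
    rw [Multiset.mem_toFinset] at hx
    exact Finset.mem_Icc.2 ⟨p.parts_pos hx, p.le_of_mem_parts hx⟩
  have h7 : zWeight (Fintype.card α) p.parts =
      ∏ j ∈ p.parts.toFinset, j ^ p.parts.count j * (p.parts.count j).factorial := by
    refine (Finset.prod_subset hsub fun x _ hx => ?_).symm
    rw [Multiset.mem_toFinset] at hx
    simp [Multiset.count_eq_zero.2 hx]
  rw [h5, h6, h7, Finset.prod_mul_distrib, ← Finset.prod_multiset_count]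
  have h8 : (p.parts.filter (2 ≤ ·)).toFinset = p.parts.toFinset.erase 1 := by
    ext x
    simp only [Multiset.mem_toFinset, Multiset.mem_filter, Finset.mem_erase]
    constructor
    · rintro ⟨a, b⟩; exact ⟨by omega, a⟩
    · rintro ⟨a, b⟩; exact ⟨b, by have := p.parts_pos b; omega⟩
  have h9 : ∏ n ∈ (p.parts.filter (2 ≤ ·)).toFinset,
      ((p.parts.filter (2 ≤ ·)).count n).factorial =
      ∏ n ∈ p.parts.toFinset.erase 1, (p.parts.count n).factorial := by
    rw [← h8]
    refine Finset.prod_congr rfl fun x hx => ?_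
    rw [Multiset.mem_toFinset, Multiset.mem_filter] at hx
    rw [Multiset.count_filter_of_pos hx.2]
  rw [h9]
  by_cases hm : 1 ∈ p.parts.toFinset
  · rw [← Finset.mul_prod_erase _ _ hm]; ring
  · rw [Finset.erase_eq_of_notMem hm]
    rw [Multiset.mem_toFinset] at hm
    simp [Multiset.count_eq_zero.2 hm]

theorem sum_perm_eq_sum_partition {α : Type*} [Fintype α] [DecidableEq α]
    (F : Multiset ℕ → ℝ) :
    ∑ σ : Equiv.Perm α,
      F (σ.cycleType + Multiset.replicate (Fintype.card α - σ.support.card) 1) =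
      (Fintype.card α).factorial *
        ∑ p : (Fintype.card α).Partition, F p.parts / zWeight (Fintype.card α) p.parts := by
  rw [← Finset.sum_fiberwise (Finset.univ : Finset (Equiv.Perm α)) fun σ => σ.partition,
    Finset.mul_sum]
  refine Finset.sum_congr rfl fun p _ => ?_
  rw [← card_partition_eq_mul_zWeight p, Finset.sum_congr rfl (g := fun _ => F p.parts)]
  · have := zWeight_ne_zero (Fintype.card α) p.parts
    simp only [Finset.sum_const, nsmul_eq_mul]
    push_cast
    field_simp
  · intro σ hσ
    rw [← (Finset.mem_filter.1 hσ).2, Equiv.Perm.parts_partition]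

theorem ewensH_eq_sum_partition (θ : ℕ → ℝ) (n : ℕ) :
    ewensH θ n = ∑ p : n.Partition, ∏ j ∈ Finset.Icc 1 n,
      thetaCoeff θ j ^ p.parts.count j / (p.parts.count j).factorial := by
  have h := sum_perm_eq_sum_partition (α := Fin n)
    fun s => ∏ j ∈ Finset.Icc 1 n, θ j ^ s.count j
  rw [Fintype.card_fin] at h
  have h1 : ∀ σ : Equiv.Perm (Fin n), ewensWeight θ n σ = ∏ j ∈ Finset.Icc 1 n,
      θ j ^ (σ.cycleType + Multiset.replicate (n - σ.support.card) 1).count j := by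
    intro σ
    refine Finset.prod_congr rfl fun j _ => ?_
    congr 1
    rw [cycleCount, Multiset.count_add, Multiset.count_replicate]
    split_ifs with h1 h2 h2
    · subst h1
      rw [Multiset.count_eq_zero.2, zero_add]
      intro h
      have := Equiv.Perm.one_lt_of_mem_cycleType h
      omega
    · omega
    · omega
    · rfl
  rw [ewensH, Finset.sum_congr rfl fun σ _ => h1 σ, h, ← mul_assoc, inv_mul_cancel₀ (by positivity),
    one_mul]
  refine Finset.sum_congr rfl fun p _ => ?_
  rw [zWeight]
  push_cast
  rw [← Finset.prod_div_distrib]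
  refine Finset.prod_congr rfl fun j hj => ?_
  have := (Finset.mem_Icc.1 hj).1
  rw [thetaCoeff, if_neg (by omega), div_pow, div_div]

/-- The `n`-th coefficient of `exp (∑ x_k t^k)`, as a sum over the partitions of `n`. -/
def expCoeff (x : ℕ → ℝ) (n : ℕ) : ℝ :=
  ∑ p : n.Partition, ∏ j ∈ Finset.Icc 1 n, x j ^ p.parts.count j / (p.parts.count j).factorial

theorem expCoeff_zero (x : ℕ → ℝ) : expCoeff x 0 = 1 := by
  simp [expCoeff]

theorem count_mul_prod_cons (x : ℕ → ℝ) {n i : ℕ} (h1 : 1 ≤ i) (hi : i ≤ n)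
    (q : (n - i).Partition) :
    ((i ::ₘ q.parts).count i : ℝ) * ∏ j ∈ Finset.Icc 1 n,
      x j ^ (i ::ₘ q.parts).count j / ((i ::ₘ q.parts).count j).factorial =
    x i * ∏ j ∈ Finset.Icc 1 (n - i), x j ^ q.parts.count j / (q.parts.count j).factorial := by
  have h2 : ∏ j ∈ Finset.Icc 1 (n - i), x j ^ q.parts.count j / (q.parts.count j).factorial =
      ∏ j ∈ Finset.Icc 1 n, x j ^ q.parts.count j / (q.parts.count j).factorial := by
    refine Finset.prod_subset (Finset.Icc_subset_Icc_right (Nat.sub_le _ _)) fun j hj hj' => ?_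
    have : j ∉ q.parts := fun h => by
      have := q.le_of_mem_parts h
      simp only [Finset.mem_Icc] at hj hj'
      omega
    simp [Multiset.count_eq_zero.2 this]
  have hmem : i ∈ Finset.Icc 1 n := Finset.mem_Icc.2 ⟨h1, hi⟩
  rw [h2, ← Finset.mul_prod_erase _ _ hmem, ← Finset.mul_prod_erase _ _ hmem, ← mul_assoc,
    ← mul_assoc]
  congr 1
  · rw [Multiset.count_cons_self, Nat.factorial_succ]
    push_cast
    field_simp
    exact pow_succ' _ _
  · refine Finset.prod_congr rfl fun j hj => ?_
    rw [Multiset.count_cons_of_ne (Finset.ne_of_mem_erase hj)]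

theorem nat_mul_expCoeff (x : ℕ → ℝ) (n : ℕ) :
    n * expCoeff x n = ∑ i ∈ Finset.Icc 1 n, i * x i * expCoeff x (n - i) := by
  classical
  have hn : ∀ p : n.Partition, (n : ℝ) = ∑ i ∈ Finset.Icc 1 n, (p.parts.count i : ℝ) * i := by
    intro p
    have h := Finset.sum_multiset_count_of_subset p.parts (Finset.Icc 1 n) (by
      intro x hx
      rw [Multiset.mem_toFinset] at hx
      exact Finset.mem_Icc.2 ⟨p.parts_pos hx, p.le_of_mem_parts hx⟩)
    rw [p.parts_sum] at h
    exact_mod_cast h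
  set W : n.Partition → ℝ := fun p =>
    ∏ j ∈ Finset.Icc 1 n, x j ^ p.parts.count j / (p.parts.count j).factorial with hW
  have h1 : n * expCoeff x n =
      ∑ i ∈ Finset.Icc 1 n, ∑ p : n.Partition, i * ((p.parts.count i : ℝ) * W p) := by
    rw [Finset.sum_comm, expCoeff, Finset.mul_sum]
    refine Finset.sum_congr rfl fun p _ => ?_
    rw [hn p, Finset.sum_mul]
    exact Finset.sum_congr rfl fun i _ => by ring
  rw [h1]
  refine Finset.sum_congr rfl fun i hi => ?_
  obtain ⟨hi1, hi2⟩ := Finset.mem_Icc.1 hi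
  rw [← Finset.mul_sum, mul_assoc]
  congr 1
  rw [expCoeff, Finset.mul_sum, ← Fintype.sum_equiv (Nat.Partition.partitionWithPartEquiv hi1 hi2)
    (fun p => (p.1.parts.count i : ℝ) * W p.1)]
  · rw [← Finset.sum_subtype (Finset.univ.filter fun p : n.Partition => i ∈ p.parts) (by simp)
      fun p => (p.parts.count i : ℝ) * W p, Finset.sum_filter_of_ne]
    intro p _ hp
    by_contra hc
    exact hp (by simp [Multiset.count_eq_zero.2 hc])
  · intro p
    rw [← count_mul_prod_cons x hi1 hi2, Nat.Partition.partitionWithPartEquiv_apply_parts,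
      Multiset.cons_erase p.2]

theorem expCoeff_succ (x : ℕ → ℝ) (n : ℕ) :
    ((n : ℝ) + 1) * expCoeff x (n + 1) =
      ∑ i ∈ Finset.range (n + 1), ((i : ℝ) + 1) * x (i + 1) * expCoeff x (n - i) := by
  have h := nat_mul_expCoeff x (n + 1)
  push_cast at h
  rw [h, show Finset.Icc 1 (n + 1) = Finset.Ico 1 (n + 2) by ext; simp; omega,
    Finset.sum_Ico_eq_sum_range]
  refine Finset.sum_congr rfl fun i _ => ?_
  rw [show n + 1 - (1 + i) = n - i by omega, add_comm 1 i]
  push_cast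
  ring

theorem iteratedDeriv_of_hasSum {g : ℂ → ℂ} {c : ℕ → ℝ}
    (hg : ∀ᶠ z in 𝓝 (0 : ℂ), HasSum (fun n => (c n : ℂ) * z ^ n) (g z)) :
    AnalyticAt ℂ g 0 ∧ ∀ n, iteratedDeriv n g 0 = n.factorial * c n := by
  have h : HasFPowerSeriesAt g (FormalMultilinearSeries.ofScalars ℂ fun n => (c n : ℂ)) 0 := by
    rw [hasFPowerSeriesAt_iff]
    filter_upwards [hg] with z hz
    simpa [mul_comm] using hz
  have h2 := h.analyticAt.hasFPowerSeriesAt.eq_formalMultilinearSeries h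
  refine ⟨h.analyticAt, fun n => ?_⟩
  have h3 := congrArg (fun p => FormalMultilinearSeries.coeff p n) h2
  simp only [FormalMultilinearSeries.coeff_ofScalars] at h3
  rw [div_eq_iff (by exact_mod_cast n.factorial_ne_zero)] at h3
  rw [h3, mul_comm]

theorem iteratedDeriv_cexp_comp {g : ℂ → ℂ} {c : ℕ → ℝ} (hc : c 0 = 0)
    (hg : ∀ᶠ z in 𝓝 (0 : ℂ), HasSum (fun n => (c n : ℂ) * z ^ n) (g z)) (n : ℕ) :
    iteratedDeriv n (fun z => Complex.exp (g z)) 0 = n.factorial * expCoeff c n := by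
  obtain ⟨ha, hd⟩ := iteratedDeriv_of_hasSum hg
  induction n using Nat.strong_induction_on with
  | _ n ih =>
    rcases n with _ | n
    · have h0 := hd 0
      simp [hc] at h0
      simp [h0, expCoeff_zero]
    · have hf : AnalyticAt ℂ (fun z => Complex.exp (g z)) 0 := ha.cexp
      have heq : deriv (fun z => Complex.exp (g z)) =ᶠ[𝓝 0]
          deriv g * fun z => Complex.exp (g z) := by
        filter_upwards [ha.eventually_analyticAt] with z hz
        rw [Pi.mul_apply, mul_comm]
        exact hz.differentiableAt.hasDerivAt.cexp.deriv
      rw [iteratedDeriv_succ', heq.iteratedDeriv_eq,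
        iteratedDeriv_mul ha.deriv.contDiffAt hf.contDiffAt]
      have h1 := congrArg (fun t : ℝ => (n.factorial : ℂ) * t) (expCoeff_succ c n)
      push_cast at h1
      rw [Nat.factorial_succ]
      push_cast
      rw [mul_comm ((n : ℂ) + 1), mul_assoc, h1, Finset.mul_sum]
      refine Finset.sum_congr rfl fun i hi => ?_
      have hin : i ≤ n := by simpa [Nat.lt_succ_iff] using hi
      rw [← iteratedDeriv_succ', hd, ih (n - i) (by omega), ← Nat.choose_mul_factorial_mul_factorial hin,
        Nat.factorial_succ]
      push_cast
      ring

theorem differentiableOn_ball_of_hasSum {g : ℂ → ℂ} {c : ℕ → ℝ} {ρ : ℝ} (hc : ∀ n, 0 ≤ c n)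
    (hg : ∀ z : ℂ, ‖z‖ < ρ → HasSum (fun n => (c n : ℂ) * z ^ n) (g z)) :
    DifferentiableOn ℂ g (Metric.ball 0 ρ) := by
  intro z hz
  rw [mem_ball_zero_iff] at hz
  obtain ⟨R, hzR, hRρ⟩ := exists_between hz
  have hR : 0 ≤ R := (norm_nonneg z).trans hzR.le
  have hs : Summable fun n => c n * R ^ n := by
    have := (hg R (by rwa [Complex.norm_real, Real.norm_of_nonneg hR])).summable
    exact_mod_cast this
  have hd : DifferentiableOn ℂ (fun w => ∑' n, (c n : ℂ) * w ^ n) (Metric.ball 0 R) := by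
    refine Complex.differentiableOn_tsum_of_summable_norm hs (fun n => by fun_prop)
      Metric.isOpen_ball fun n w hw => ?_
    rw [mem_ball_zero_iff] at hw
    rw [norm_mul, norm_pow, Complex.norm_real, Real.norm_of_nonneg (hc n)]
    have := hc n
    gcongr
  have hmem : Metric.ball (0 : ℂ) R ∈ 𝓝 z :=
    Metric.isOpen_ball.mem_nhds (mem_ball_zero_iff.2 hzR)
  refine ((hd.differentiableAt hmem).congr_of_eventuallyEq ?_).differentiableWithinAt
  filter_upwards [hmem] with w hw
  rw [mem_ball_zero_iff] at hw
  exact (hg w (hw.trans hRρ)).tsum_eq.symm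

theorem norm_ofReal_mul_exp_mul_I {r : ℝ} (hr : 0 ≤ r) (φ : ℝ) :
    ‖(r : ℂ) * Complex.exp (φ * Complex.I)‖ = r := by
  rw [norm_mul, Complex.norm_exp_ofReal_mul_I, mul_one, Complex.norm_real, Real.norm_of_nonneg hr]

theorem integral_cexp_comp_eq {g : ℂ → ℂ} {c : ℕ → ℝ} {ρ : ℝ} (hc : ∀ n, 0 ≤ c n) (hc0 : c 0 = 0)
    (hg : ∀ z : ℂ, ‖z‖ < ρ → HasSum (fun n => (c n : ℂ) * z ^ n) (g z)) {r : ℝ} (hr : 0 < r)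
    (hrρ : r < ρ) (n : ℕ) :
    ∫ φ in -Real.pi..Real.pi, Complex.exp (g (r * Complex.exp (φ * Complex.I)) -
      φ * Complex.I * n) = 2 * Real.pi * r ^ n * expCoeff c n := by
  have hd : DifferentiableOn ℂ (fun z => Complex.exp (g z)) (Metric.closedBall 0 r) :=
    ((differentiableOn_ball_of_hasSum hc hg).mono (Metric.closedBall_subset_ball hrρ)).cexp
  have h := hd.circleIntegral_one_div_sub_center_pow_smul hr n
  rw [iteratedDeriv_cexp_comp hc0 (by
    filter_upwards [Metric.ball_mem_nhds (0 : ℂ) (hr.trans hrρ)] with z hz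
    exact hg z (mem_ball_zero_iff.1 hz)) n, circleIntegral] at h
  have hr' : (r : ℂ) ≠ 0 := by exact_mod_cast hr.ne'
  have hn : (n.factorial : ℂ) ≠ 0 := by exact_mod_cast n.factorial_ne_zero
  have hI := Complex.I_ne_zero
  have hper : Function.Periodic (fun φ : ℝ => Complex.exp (g (r * Complex.exp (φ * Complex.I)) -
      φ * Complex.I * n)) (2 * Real.pi) := by
    intro φ
    have h1 : Complex.exp (((φ + 2 * Real.pi : ℝ) : ℂ) * Complex.I) =
        Complex.exp (φ * Complex.I) := by
      push_cast
      rw [add_mul, Complex.exp_periodic]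
    have h2 : ∀ ψ : ℝ, Complex.exp (-(ψ * Complex.I * n)) =
        (Complex.exp (ψ * Complex.I) ^ n)⁻¹ := by
      intro ψ
      rw [Complex.exp_neg, ← Complex.exp_nat_mul, mul_comm]
    simp only [sub_eq_add_neg, Complex.exp_add, h1, h2]
  have h3 := hper.intervalIntegral_add_eq (-Real.pi) 0
  rw [show -Real.pi + 2 * Real.pi = Real.pi by ring, zero_add] at h3
  rw [h3]
  have h4 : ∀ φ : ℝ, deriv (circleMap 0 r) φ • ((1 / (circleMap 0 r φ - 0) ^ (n + 1)) •
      Complex.exp (g (circleMap 0 r φ))) = Complex.I / r ^ n *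
      Complex.exp (g (r * Complex.exp (φ * Complex.I)) - φ * Complex.I * n) := by
    intro φ
    rw [deriv_circleMap, Complex.exp_sub, mul_comm ((φ : ℂ) * Complex.I) n, Complex.exp_nat_mul]
    have := Complex.exp_ne_zero ((φ : ℂ) * Complex.I)
    simp only [circleMap, zero_add, sub_zero, smul_eq_mul]
    field_simp
    ring
  simp only [h4] at h
  rw [intervalIntegral.integral_const_mul, smul_eq_mul] at h
  generalize (∫ φ in (0 : ℝ)..2 * Real.pi, Complex.exp (g (r * Complex.exp (φ * Complex.I)) -
    φ * Complex.I * n)) = J at h ⊢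
  field_simp at h
  linear_combination h

namespace IsLogAdmissible

variable {g : ℂ → ℂ} {c : ℕ → ℝ} {ρ : ℝ} {a b δ : ℝ → ℝ}

theorem differentiableOn (h : IsLogAdmissible g c ρ a b δ) :
    DifferentiableOn ℂ g (Metric.ball 0 ρ) :=
  differentiableOn_ball_of_hasSum h.coeff_nonneg h.series

theorem continuous_comp (h : IsLogAdmissible g c ρ a b δ) {r : ℝ} (hr : r ∈ Set.Ico (0 : ℝ) ρ) :
    Continuous fun φ : ℝ => g (r * Complex.exp (φ * Complex.I)) := by
  refine h.differentiableOn.continuousOn.comp_continuous (by fun_prop) fun φ => ?_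
  rw [mem_ball_zero_iff, norm_ofReal_mul_exp_mul_I hr.1]
  exact hr.2

theorem a_eq (h : IsLogAdmissible g c ρ a b δ) {r : ℝ} (hr : r ∈ Set.Ico (0 : ℝ) ρ) :
    (a r : ℂ) = r * deriv g r := by
  obtain ⟨ε, -, hε⟩ := h.approx
  have hδ := h.delta_pos r hr
  have h1 : HasDerivAt (fun φ : ℝ => g (r * Complex.exp (φ * Complex.I)) -
      (g r + φ * Complex.I * a r - (φ : ℂ) ^ 2 / 2 * b r)) 0 0 := by
    have hO : (fun φ : ℝ => g (r * Complex.exp (φ * Complex.I)) -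
      (g r + φ * Complex.I * a r - (φ : ℂ) ^ 2 / 2 * b r)) =O[𝓝 0] fun φ => ‖φ - 0‖ ^ 3 := by
      refine Asymptotics.IsBigO.of_bound (ε r * (δ r)⁻¹ ^ 3) ?_
      filter_upwards [Metric.closedBall_mem_nhds (0 : ℝ) hδ] with φ hφ
      rw [mem_closedBall_zero_iff, Real.norm_eq_abs] at hφ
      refine (hε r hr φ hφ).trans_eq ?_
      rw [sub_zero, norm_pow, norm_norm, Real.norm_eq_abs]
      ring
    have := (hO.hasFDerivAt (𝕜 := ℝ) (by norm_num)).hasDerivAt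
    simpa using this
  have hmem : Metric.ball (0 : ℂ) ρ ∈ 𝓝 (r : ℂ) := Metric.isOpen_ball.mem_nhds (by
    rw [mem_ball_zero_iff, Complex.norm_real, Real.norm_of_nonneg hr.1]; exact hr.2)
  have hg : HasDerivAt g (deriv g r) (r * Complex.exp ((0 : ℝ) * Complex.I)) := by
    simpa using (h.differentiableOn.differentiableAt hmem).hasDerivAt
  have hφ : HasDerivAt (fun φ : ℝ => (φ : ℂ)) 1 0 := Complex.ofRealCLM.hasDerivAt
  have h2 : HasDerivAt (fun φ : ℝ => (r : ℂ) * Complex.exp (φ * Complex.I)) (r * Complex.I) 0 := by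
    simpa using ((hφ.mul_const Complex.I).cexp).const_mul (r : ℂ)
  have h3 := hg.comp (0 : ℝ) h2
  have h4 : HasDerivAt (fun φ : ℝ => g r + φ * Complex.I * a r - (φ : ℂ) ^ 2 / 2 * b r)
      (Complex.I * a r) 0 := by
    simpa using (((hφ.mul_const Complex.I).mul_const (a r : ℂ)).const_add (g r)).fun_sub
      (((hφ.fun_pow 2).div_const 2).mul_const (b r : ℂ))
  have h5 := h1.unique (h3.sub h4)
  have : Complex.I * (a r - r * deriv g r) = 0 := by linear_combination h5
  simpa [sub_eq_zero, Complex.I_ne_zero] using this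

theorem exists_a_le (h : IsLogAdmissible g c ρ a b δ) {s : ℝ} (hs : s < ρ) :
    ∃ M, ∀ r ∈ Set.Icc 0 s, a r ≤ M := by
  have hc : ContinuousOn (fun z => z * deriv g z) (Metric.closedBall 0 s) :=
    continuousOn_id.mul ((h.differentiableOn.deriv Metric.isOpen_ball).continuousOn.mono
      (Metric.closedBall_subset_ball hs))
  obtain ⟨M, hM⟩ := (isCompact_closedBall (0 : ℂ) s).exists_bound_of_continuousOn hc
  refine ⟨M, fun r hr => ?_⟩
  have h1 := hM r (by
    rw [mem_closedBall_zero_iff, Complex.norm_real, Real.norm_of_nonneg hr.1]; exact hr.2)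
  rw [← h.a_eq ⟨hr.1, hr.2.trans_lt hs⟩, Complex.norm_real] at h1
  exact (le_abs_self _).trans h1

theorem tendsto_nhdsLT (h : IsLogAdmissible g c ρ a b δ) {ι : Type*} {l : Filter ι} {r : ι → ℝ}
    (hr : ∀ᶠ i in l, r i ∈ Set.Ico (0 : ℝ) ρ) (ha : Tendsto (fun i => a (r i)) l atTop) :
    Tendsto r l (𝓝[<] ρ) := by
  refine tendsto_nhdsWithin_iff.2 ⟨tendsto_order.2 ⟨fun s hs => ?_, fun s hs => ?_⟩, ?_⟩
  · obtain ⟨M, hM⟩ := h.exists_a_le hs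
    filter_upwards [hr, ha.eventually_gt_atTop M] with i hi hi'
    by_contra! hc
    exact absurd (hM _ ⟨hi.1, hc⟩) (not_le.2 hi')
  · filter_upwards [hr] with i hi using hi.2.trans hs
  · filter_upwards [hr] with i hi using hi.2

theorem norm_cexp_sub_gaussian_le (h : IsLogAdmissible g c ρ a b δ) {r e : ℝ}
    (hr : r ∈ Set.Ico (0 : ℝ) ρ) (he : e ≤ 1)
    (happrox : ∀ φ : ℝ, |φ| ≤ δ r →
      ‖g (r * Complex.exp (φ * Complex.I)) -
          (g r + φ * Complex.I * a r - (φ : ℂ) ^ 2 / 2 * b r)‖ ≤ e * |φ| ^ 3 * (δ r)⁻¹ ^ 3)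
    {φ : ℝ} (hφ : |φ| ≤ Real.pi) :
    ‖Complex.exp (g (r * Complex.exp (φ * Complex.I)) - g r - φ * Complex.I * a r) -
      (Real.exp (-(b r / 2) * φ ^ 2) : ℝ)‖ ≤
      2 * e * Real.exp (-(b r / 2) * φ ^ 2) + 4 * Real.exp (-(b r / 2) * δ r ^ 2) := by
  have hδ := h.delta_pos r hr
  have hb := h.b_nonneg r hr
  have he0 : 0 ≤ e := by
    have := (norm_nonneg _).trans (happrox (δ r) (abs_of_pos hδ).le)
    rw [abs_of_pos hδ, mul_assoc, ← mul_pow, mul_inv_cancel₀ hδ.ne'] at this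
    simpa using this
  rcases le_or_gt |φ| (δ r) with hle | hgt
  · set w := g (r * Complex.exp (φ * Complex.I)) -
          (g r + φ * Complex.I * a r - (φ : ℂ) ^ 2 / 2 * b r) with hw
    have hwe : ‖w‖ ≤ e := by
      refine (happrox φ hle).trans ?_
      rw [mul_assoc, ← mul_pow]
      refine mul_le_of_le_one_right he0 (pow_le_one₀ (by positivity) ?_)
      rwa [← div_eq_mul_inv, div_le_one hδ]
    have h1 : Complex.exp (g (r * Complex.exp (φ * Complex.I)) - g r - φ * Complex.I * a r) -
        (Real.exp (-(b r / 2) * φ ^ 2) : ℝ) =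
        (Real.exp (-(b r / 2) * φ ^ 2) : ℝ) * (Complex.exp w - 1) := by
      rw [mul_sub, mul_one, Complex.ofReal_exp, ← Complex.exp_add, hw]
      push_cast
      ring_nf
    rw [h1, norm_mul, Complex.norm_real, Real.norm_of_nonneg (Real.exp_pos _).le]
    have h2 := Complex.norm_exp_sub_one_le (hwe.trans he)
    have h3 := Real.exp_pos (-(b r / 2) * φ ^ 2)
    have h4 := Real.exp_pos (-(b r / 2) * δ r ^ 2)
    nlinarith
  · have hre : ∀ ψ : ℝ, |ψ| = δ r → (g (r * Complex.exp (ψ * Complex.I))).re ≤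
        (g r).re - b r / 2 * δ r ^ 2 + e := by
      intro ψ hψ
      have h1 := (Complex.re_le_norm _).trans (happrox ψ hψ.le)
      rw [hψ, mul_assoc e, ← mul_pow, mul_inv_cancel₀ hδ.ne', one_pow, mul_one] at h1
      have h2 : ((ψ : ℂ) * Complex.I * a r).re = 0 := by simp
      have h3 : ((ψ : ℂ) ^ 2 / 2 * b r).re = ψ ^ 2 / 2 * b r := by
        have : (ψ : ℂ) ^ 2 / 2 * b r = ((ψ ^ 2 / 2 * b r : ℝ) : ℂ) := by push_cast; ring
        rw [this, Complex.ofReal_re]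
      rw [Complex.sub_re, Complex.sub_re, Complex.add_re, h2, h3, ← sq_abs, hψ] at h1
      linarith
    have h1 := h.mono r hr φ hgt hφ
    have h2 := hre (δ r) (abs_of_pos hδ)
    have h3 := hre (-δ r) (by rw [abs_neg, abs_of_pos hδ])
    rw [Complex.ofReal_neg] at h3
    have h4 := h1.trans (max_le h2 h3)
    have h5 : ‖Complex.exp (g (r * Complex.exp (φ * Complex.I)) - g r - φ * Complex.I * a r)‖ ≤
        3 * Real.exp (-(b r / 2) * δ r ^ 2) := by
      rw [Complex.norm_exp]
      have h6 : ((φ : ℂ) * Complex.I * a r).re = 0 := by simp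
      rw [Complex.sub_re, Complex.sub_re, h6]
      have h7 : (3 : ℝ) ≥ Real.exp 1 := Real.exp_one_lt_three.le
      calc _ ≤ Real.exp (1 + -(b r / 2) * δ r ^ 2) := Real.exp_le_exp.2 (by linarith)
        _ = Real.exp 1 * Real.exp (-(b r / 2) * δ r ^ 2) := Real.exp_add _ _
        _ ≤ _ := by gcongr
    have h6 : Real.exp (-(b r / 2) * φ ^ 2) ≤ Real.exp (-(b r / 2) * δ r ^ 2) := by
      rw [← sq_abs φ]
      refine Real.exp_le_exp.2 ?_
      have : δ r ^ 2 ≤ |φ| ^ 2 := by gcongr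
      nlinarith
    refine (norm_sub_le _ _).trans ?_
    rw [Complex.norm_real, Real.norm_of_nonneg (Real.exp_pos _).le]
    have := mul_nonneg he0 (Real.exp_pos (-(b r / 2) * φ ^ 2)).le
    linarith

end IsLogAdmissible

theorem tendsto_sqrt_mul_integral_gaussian :
    Tendsto (fun b : ℝ => √(b / (2 * Real.pi)) *
      ∫ φ in -Real.pi..Real.pi, Real.exp (-(b / 2) * φ ^ 2)) atTop (𝓝 1) := by
  have h1 : Integrable fun u : ℝ => Real.exp (-(1 / 2) * u ^ 2) :=
    integrable_exp_neg_mul_sq (by norm_num)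
  have h2 : Tendsto (fun b : ℝ => √b * Real.pi) atTop atTop :=
    Real.tendsto_sqrt_atTop.atTop_mul_const Real.pi_pos
  have h3 : Tendsto (fun b : ℝ => √b * -Real.pi) atTop atBot := by
    simp only [mul_neg]
    exact tendsto_neg_atTop_atBot.comp h2
  have h4 := (intervalIntegral_tendsto_integral h1 h3 h2).const_mul (√(2 * Real.pi))⁻¹
  rw [integral_gaussian, show Real.pi / (1 / 2) = 2 * Real.pi by ring,
    inv_mul_cancel₀ (by positivity)] at h4
  refine h4.congr' ?_
  filter_upwards [eventually_gt_atTop 0] with b hb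
  rw [← intervalIntegral.smul_integral_comp_mul_left, Real.sqrt_div hb.le, smul_eq_mul,
    ← mul_assoc, inv_mul_eq_div]
  congr 1
  refine intervalIntegral.integral_congr fun φ _ => ?_
  rw [mul_pow, Real.sq_sqrt hb.le]
  ring_nf

namespace IsLogAdmissible

variable {g : ℂ → ℂ} {c : ℕ → ℝ} {ρ : ℝ} {a b δ : ℝ → ℝ}

theorem tendsto_sqrt_mul_exp (h : IsLogAdmissible g c ρ a b δ) :
    Tendsto (fun r => √(b r) * Real.exp (-(b r / 2) * δ r ^ 2)) (𝓝[<] ρ) (𝓝 0) := by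
  have h1 := Real.tendsto_exp_atBot.comp
    (tendsto_neg_atTop_atBot.comp ((h.width 1 one_pos).atTop_mul_const (half_pos one_pos)))
  refine h1.congr' ?_
  filter_upwards [h.b_div.eventually_gt_atTop 0] with r hb
  rw [Real.sqrt_eq_rpow, Real.rpow_def_of_pos hb, ← Real.exp_add]
  simp only [Function.comp]
  ring_nf

theorem tendsto_sqrt_mul_integral (h : IsLogAdmissible g c ρ a b δ) :
    Tendsto (fun r : ℝ => (√(b r / (2 * Real.pi)) : ℂ) * ∫ φ in -Real.pi..Real.pi,
      Complex.exp (g (r * Complex.exp (φ * Complex.I)) - g r - φ * Complex.I * a r))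
      (𝓝[<] ρ) (𝓝 1) := by
  obtain ⟨ε, hε0, hε⟩ := h.approx
  have h1 : Tendsto (fun r : ℝ => ((√(b r / (2 * Real.pi)) *
      ∫ φ in -Real.pi..Real.pi, Real.exp (-(b r / 2) * φ ^ 2) : ℝ) : ℂ)) (𝓝[<] ρ) (𝓝 1) := by
    have := (Complex.continuous_ofReal.tendsto _).comp
      (tendsto_sqrt_mul_integral_gaussian.comp h.b_div)
    rwa [Complex.ofReal_one] at this
  have h2 : Tendsto (fun r => 2 * ε r * (√(b r / (2 * Real.pi)) *
      ∫ φ in -Real.pi..Real.pi, Real.exp (-(b r / 2) * φ ^ 2)) +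
      (√(2 * Real.pi))⁻¹ * (8 * Real.pi) * (√(b r) * Real.exp (-(b r / 2) * δ r ^ 2)))
      (𝓝[<] ρ) (𝓝 0) := by
    have := ((hε0.const_mul 2).mul (tendsto_sqrt_mul_integral_gaussian.comp h.b_div)).add
      (h.tendsto_sqrt_mul_exp.const_mul ((√(2 * Real.pi))⁻¹ * (8 * Real.pi)))
    simpa using this
  rw [← tendsto_sub_nhds_zero_iff] at h1 ⊢
  have hmem : ∀ᶠ r in 𝓝[<] ρ, r ∈ Set.Ico (0 : ℝ) ρ := by
    filter_upwards [Ioo_mem_nhdsLT h.rho_pos] with r hr using ⟨hr.1.le, hr.2⟩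
  have h3 : Tendsto (fun r : ℝ => (√(b r / (2 * Real.pi)) : ℂ) * (∫ φ in -Real.pi..Real.pi,
      Complex.exp (g (r * Complex.exp (φ * Complex.I)) - g r - φ * Complex.I * a r)) -
      ((√(b r / (2 * Real.pi)) *
      ∫ φ in -Real.pi..Real.pi, Real.exp (-(b r / 2) * φ ^ 2) : ℝ) : ℂ)) (𝓝[<] ρ) (𝓝 0) := by
    refine squeeze_zero_norm' ?_ h2
    filter_upwards [hmem, hε0.eventually_le_const one_pos] with r hr he
    have hc1 : Continuous fun φ : ℝ => Complex.exp
        (g (r * Complex.exp (φ * Complex.I)) - g r - φ * Complex.I * a r) := by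
      exact Complex.continuous_exp.comp
        (((h.continuous_comp hr).sub continuous_const).sub (by fun_prop))
    have hc2 : Continuous fun φ : ℝ => Real.exp (-(b r / 2) * φ ^ 2) := by fun_prop
    have hc3 : Continuous fun φ : ℝ => ((Real.exp (-(b r / 2) * φ ^ 2) : ℝ) : ℂ) :=
      Complex.continuous_ofReal.comp hc2
    have hle : -Real.pi ≤ Real.pi := by linarith [Real.pi_pos]
    rw [Complex.ofReal_mul, ← mul_sub, ← intervalIntegral.integral_ofReal,
      ← intervalIntegral.integral_sub (hc1.intervalIntegrable _ _)
        (hc3.intervalIntegrable _ _), norm_mul,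
      Complex.norm_real, Real.norm_of_nonneg (Real.sqrt_nonneg _)]
    have hi : ‖∫ φ in -Real.pi..Real.pi, (Complex.exp
        (g (r * Complex.exp (φ * Complex.I)) - g r - φ * Complex.I * a r) -
        (Real.exp (-(b r / 2) * φ ^ 2) : ℝ))‖ ≤
        ∫ φ in -Real.pi..Real.pi, (2 * ε r * Real.exp (-(b r / 2) * φ ^ 2) +
          4 * Real.exp (-(b r / 2) * δ r ^ 2)) := by
      refine intervalIntegral.norm_integral_le_of_norm_le hle (Eventually.of_forall fun φ hφ => ?_)
        (Continuous.intervalIntegrable (by fun_prop) _ _)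
      exact h.norm_cexp_sub_gaussian_le hr he (hε r hr) (abs_le.2 ⟨hφ.1.le, hφ.2⟩)
    rw [intervalIntegral.integral_add (Continuous.intervalIntegrable (by fun_prop) _ _)
      (Continuous.intervalIntegrable (by fun_prop) _ _), intervalIntegral.integral_const_mul,
      intervalIntegral.integral_const, smul_eq_mul] at hi
    refine (mul_le_mul_of_nonneg_left hi (Real.sqrt_nonneg _)).trans_eq ?_
    rw [Real.sqrt_div (h.b_nonneg r hr)]
    ring
  simpa using h3.add h1

end IsLogAdmissible

theorem gThetaC_ofReal (θ : ℕ → ℝ) (t : ℝ) : gThetaC θ t = gThetaR θ t := by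
  rw [gThetaC, gThetaR, Complex.ofReal_tsum]
  push_cast
  rfl

/-- **Corollary 3.1 (first part).** Let `g_θ` be log-admissible with associated
functions `a`, `b` and let `r_x` be the unique solution of `a(r) = x`. Then
`h_n = (2π b(r_n))^{-1/2} r_n^{-n} exp(g_θ(r_n)) (1 + o(1))` as `n → ∞`. -/
theorem asymptotic_ewensH
    (θ : ℕ → ℝ) (hθ : ∀ j, 0 ≤ θ j) (ρ : ℝ) (a b δ : ℝ → ℝ)
    (hadm : IsLogAdmissible (gThetaC θ) (thetaCoeff θ) ρ a b δ)
    (r : ℝ → ℝ) (hr : ∀ x > 0, r x ∈ Set.Ico 0 ρ ∧ a (r x) = x)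
    (hru : ∀ x > 0, ∀ y ∈ Set.Ico (0 : ℝ) ρ, a y = x → y = r x) :
    (fun n : ℕ => ewensH θ n) ~[atTop]
      (fun n : ℕ =>
        Real.exp (gThetaR θ (r n)) / (Real.sqrt (2 * Real.pi * b (r n)) * r n ^ n)) := by
  have hmem : ∀ᶠ n : ℕ in atTop, r n ∈ Set.Ico (0 : ℝ) ρ ∧ a (r n) = n := by
    filter_upwards [eventually_gt_atTop 0] with n hn
    exact hr n (by exact_mod_cast hn)
  have hlim : Tendsto (fun n : ℕ => r n) atTop (𝓝[<] ρ) := by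
    refine hadm.tendsto_nhdsLT (hmem.mono fun n h => h.1) ?_
    exact tendsto_natCast_atTop_atTop.congr' (hmem.mono fun n h => h.2.symm)
  have hpos : ∀ᶠ n : ℕ in atTop, 0 < r n :=
    hlim.eventually (by
      filter_upwards [Ioo_mem_nhdsLT hadm.rho_pos] with s hs using hs.1)
  have hb : ∀ᶠ n : ℕ in atTop, 0 < b (r n) :=
    hlim.eventually (hadm.b_div.eventually_gt_atTop 0)
  rw [isEquivalent_iff_tendsto_one]
  · have h := (Complex.continuous_re.tendsto _).comp (hadm.tendsto_sqrt_mul_integral.comp hlim)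
    rw [Complex.one_re] at h
    refine h.congr' ?_
    filter_upwards [hmem, hpos, hb] with n hn hn0 hbn
    have hint := integral_cexp_comp_eq hadm.coeff_nonneg (by simp [thetaCoeff]) hadm.series hn0
      hn.1.2 n
    have hsplit : ∀ φ : ℝ, Complex.exp (gThetaC θ (r n * Complex.exp (φ * Complex.I)) -
        gThetaC θ (r n) - φ * Complex.I * a (r n)) = Complex.exp (-gThetaC θ (r n)) *
        Complex.exp (gThetaC θ (r n * Complex.exp (φ * Complex.I)) - φ * Complex.I * n) := by
      intro φ
      rw [← Complex.exp_add, hn.2]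
      push_cast
      ring_nf
    simp only [Function.comp, hsplit, Pi.div_apply]
    rw [intervalIntegral.integral_const_mul, hint, gThetaC_ofReal]
    have hreal : (√(b (r n) / (2 * Real.pi)) : ℂ) * (Complex.exp (-(gThetaR θ (r n) : ℂ)) *
        (2 * Real.pi * (r n : ℂ) ^ n * expCoeff (thetaCoeff θ) n)) =
        ((√(b (r n) / (2 * Real.pi)) * (Real.exp (-gThetaR θ (r n)) *
          (2 * Real.pi * r n ^ n * expCoeff (thetaCoeff θ) n)) : ℝ) : ℂ) := by
      push_cast
      rfl
    rw [hreal, Complex.ofReal_re, ewensH_eq_sum_partition, ← expCoeff, Real.exp_neg,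
      Real.sqrt_div hbn.le, Real.sqrt_mul (show 0 ≤ 2 * Real.pi by positivity) (b (r n))]
    have h2 : √(2 * Real.pi) * √(2 * Real.pi) = 2 * Real.pi := Real.mul_self_sqrt (by positivity)
    have h3 : √(2 * Real.pi) ≠ 0 := by positivity
    have h4 : √(b (r n)) ≠ 0 := by positivity
    generalize √(2 * Real.pi) = s at h2 h3 ⊢
    rw [← h2]
    field_simp
  · filter_upwards [hpos, hb] with n hn hbn
    positivity
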